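/- For every integer n ≥ 1, M̄_n ≤ M_{2n} ≤ n · M̄_n. -/

import Mathlib

open Filter

/-- `x` lies strictly between `p` and `q`. -/
def StrictlyBetween (p q x : ℕ) : Prop := min p q < x ∧ x < max p q

/-- Two arcs `{p, q}` and `{r, s}` cross if exactly one of `r`, `s` lies strictly
between `p` and `q`. -/
def ArcsCross (p q r s : ℕ) : Prop :=
  Xor' (StrictlyBetween p q r) (StrictlyBetween p q s)

/-- `a` (with one-based indexing, only the values `a 1, …, a n` being relevant)
is an open meandric permutation of order `n`: it is a permutation of `{1, …, n}`
with `a i ≡ i (mod 2)`, whose upper arcs (pairs `{a i, a (i+1)}` for odd `i < n`)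
are pairwise noncrossing, whose lower arcs (pairs `{a i, a (i+1)}` for even
`1 ≤ i < n`) are pairwise noncrossing, such that no lower arc strictly encloses
`a 1`, and no lower arc (if `n` is even) resp. upper arc (if `n` is odd)
strictly encloses `a n`. -/
def IsOpenMeandricPerm (n : ℕ) (a : ℕ → ℕ) : Prop :=
  1 ≤ n ∧
  (∀ i, 1 ≤ i → i ≤ n → 1 ≤ a i ∧ a i ≤ n) ∧
  (∀ i j, 1 ≤ i → i ≤ n → 1 ≤ j → j ≤ n → a i = a j → i = j) ∧
  (∀ i, 1 ≤ i → i ≤ n → a i % 2 = i % 2) ∧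
  (∀ i j, Odd i → i < n → Odd j → j < n →
      ¬ ArcsCross (a i) (a (i + 1)) (a j) (a (j + 1))) ∧
  (∀ i j, Even i → 1 ≤ i → i < n → Even j → 1 ≤ j → j < n →
      ¬ ArcsCross (a i) (a (i + 1)) (a j) (a (j + 1))) ∧
  (∀ i, Even i → 1 ≤ i → i < n → ¬ StrictlyBetween (a i) (a (i + 1)) (a 1)) ∧
  (if Even n
    then ∀ i, Even i → 1 ≤ i → i < n → ¬ StrictlyBetween (a i) (a (i + 1)) (a n)
    else ∀ i, Odd i → i < n → ¬ StrictlyBetween (a i) (a (i + 1)) (a n))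

/-- An open meandric permutation of order `n` is irreducible if there are no
indices `1 ≤ k₁ < k₂ ≤ n` with `2 < k₂ - k₁ ≤ n - 2` such that the values
`a k₁, …, a k₂` form an interval of integers, i.e. their max minus their min
equals `k₂ - k₁`. -/
def IsIrreducibleMeander (n : ℕ) (a : ℕ → ℕ) : Prop :=
  ¬ ∃ k₁ k₂ : ℕ, ∃ h : k₁ < k₂, 1 ≤ k₁ ∧ k₂ ≤ n ∧ 2 < k₂ - k₁ ∧ k₂ - k₁ ≤ n - 2 ∧
    (Finset.Icc k₁ k₂).sup' (Finset.nonempty_Icc.mpr h.le) a -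
      (Finset.Icc k₁ k₂).inf' (Finset.nonempty_Icc.mpr h.le) a = k₂ - k₁

/-- An open meandric permutation of order `n` is prime if `a 1 ≠ 1` and no proper
initial segment `a 1, …, a j` (`2 ≤ j < n`) is a permutation of `{1, …, j}`. -/
def IsPrimeMeander (n : ℕ) (a : ℕ → ℕ) : Prop :=
  a 1 ≠ 1 ∧ ¬ ∃ j, 2 ≤ j ∧ j < n ∧ (Finset.Icc 1 j).image a = Finset.Icc 1 j

/-- `a` (with one-based indexing) is a closed meandric permutation of order `n`:
a permutation of `{1, …, 2n}` with `a 1 = 1`, `a i ≡ i (mod 2)`, pairwise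
noncrossing upper arcs `{a i, a (i+1)}` (odd `i < 2n`) and pairwise noncrossing
lower arcs, the latter being the `{a i, a (i+1)}` for even `1 ≤ i < 2n` together
with the wrap-around arc `{a (2n), a 1}`. -/
def IsClosedMeandricPerm (n : ℕ) (a : ℕ → ℕ) : Prop :=
  1 ≤ n ∧ a 1 = 1 ∧
  (∀ i, 1 ≤ i → i ≤ 2 * n → 1 ≤ a i ∧ a i ≤ 2 * n) ∧
  (∀ i j, 1 ≤ i → i ≤ 2 * n → 1 ≤ j → j ≤ 2 * n → a i = a j → i = j) ∧
  (∀ i, 1 ≤ i → i ≤ 2 * n → a i % 2 = i % 2) ∧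
  (∀ i j, Odd i → i < 2 * n → Odd j → j < 2 * n →
      ¬ ArcsCross (a i) (a (i + 1)) (a j) (a (j + 1))) ∧
  (∀ i j, Even i → 1 ≤ i → i < 2 * n → Even j → 1 ≤ j → j < 2 * n →
      ¬ ArcsCross (a i) (a (i + 1)) (a j) (a (j + 1))) ∧
  (∀ i, Even i → 1 ≤ i → i < 2 * n →
      ¬ ArcsCross (a i) (a (i + 1)) (a (2 * n)) (a 1) ∧
      ¬ ArcsCross (a (2 * n)) (a 1) (a i) (a (i + 1)))

/-- `M n`: the number of open meandric permutations of order `n` (each counted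
once via the normalization `a i = 0` outside `{1, …, n}`). -/
noncomputable def openMeanderCount (n : ℕ) : ℕ :=
  Set.ncard {a : ℕ → ℕ | IsOpenMeandricPerm n a ∧ ∀ i, i < 1 ∨ n < i → a i = 0}

/-- `M^{Irr} n`: the number of irreducible open meandric permutations of order `n`. -/
noncomputable def irrMeanderCount (n : ℕ) : ℕ :=
  Set.ncard {a : ℕ → ℕ | IsOpenMeandricPerm n a ∧ IsIrreducibleMeander n a ∧
    ∀ i, i < 1 ∨ n < i → a i = 0}

/-- `M^{(P)} n`: the number of prime open meandric permutations of order `n`. -/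
noncomputable def primeMeanderCount (n : ℕ) : ℕ :=
  Set.ncard {a : ℕ → ℕ | IsOpenMeandricPerm n a ∧ IsPrimeMeander n a ∧
    ∀ i, i < 1 ∨ n < i → a i = 0}

/-- `M̄ n`: the number of closed meandric permutations of order `n`. -/
noncomputable def closedMeanderCount (n : ℕ) : ℕ :=
  Set.ncard {a : ℕ → ℕ | IsClosedMeandricPerm n a ∧ ∀ i, i < 1 ∨ 2 * n < i → a i = 0}

/-- The successor of an index in the cyclic order on `{1, …, N}`. -/
def cyclicSucc (N i : ℕ) : ℕ := if i < N then i + 1 else 1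

/-- Cyclic translation by `m` of the indices `{1, …, N}`. -/
def cyclicShift (N m i : ℕ) : ℕ := if i + m ≤ N then i + m else i + m - N

/-- The sequence `a 1, …, a N` rotated cyclically by `m` places, extended by zero. -/
def rotateSeq (N m : ℕ) (a : ℕ → ℕ) : ℕ → ℕ :=
  fun i => if 1 ≤ i ∧ i ≤ N then a (cyclicShift N m i) else 0

lemma cyclicShift_mem {N m i : ℕ} (hm : m ≤ N) (h1 : 1 ≤ i) (hi : i ≤ N) :
    1 ≤ cyclicShift N m i ∧ cyclicShift N m i ≤ N := by
  unfold cyclicShift; split_ifs <;> omega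

lemma cyclicShift_inj {N m i j : ℕ} (h1 : 1 ≤ i) (hi : i ≤ N) (hj1 : 1 ≤ j) (hj : j ≤ N)
    (h : cyclicShift N m i = cyclicShift N m j) : i = j := by
  unfold cyclicShift at h; split_ifs at h <;> omega

lemma cyclicShift_cyclicSucc {N m i : ℕ} (hm : m < N) (hi : i ≤ N) :
    cyclicShift N m (cyclicSucc N i) = cyclicSucc N (cyclicShift N m i) := by
  unfold cyclicShift cyclicSucc; split_ifs <;> omega

lemma cyclicShift_mod_two (n k i : ℕ) :
    cyclicShift (2 * n) (2 * k) i % 2 = i % 2 := by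
  unfold cyclicShift; split_ifs <;> omega

lemma rotateSeq_of_mem {N m i : ℕ} {a : ℕ → ℕ} (h1 : 1 ≤ i) (hi : i ≤ N) :
    rotateSeq N m a i = a (cyclicShift N m i) := if_pos ⟨h1, hi⟩

lemma rotateSeq_of_not_mem {N m i : ℕ} {a : ℕ → ℕ} (h : i < 1 ∨ N < i) :
    rotateSeq N m a i = 0 := if_neg (by omega)

lemma rotateSeq_cyclicSucc {N m i : ℕ} {a : ℕ → ℕ} (hm : m < N) (h1 : 1 ≤ i) (hi : i ≤ N) :
    rotateSeq N m a (cyclicSucc N i) = a (cyclicSucc N (cyclicShift N m i)) := by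
  rw [rotateSeq_of_mem, cyclicShift_cyclicSucc hm hi] <;>
    (unfold cyclicSucc; split_ifs <;> omega)

lemma rotateSeq_rotateSeq {N m : ℕ} {a : ℕ → ℕ} (hm : m ≤ N)
    (ha : ∀ i, i < 1 ∨ N < i → a i = 0) : rotateSeq N (N - m) (rotateSeq N m a) = a := by
  funext i
  by_cases hi : 1 ≤ i ∧ i ≤ N
  · obtain ⟨h1, h2⟩ := cyclicShift_mem (m := N - m) (by omega) hi.1 hi.2
    rw [rotateSeq_of_mem hi.1 hi.2, rotateSeq_of_mem h1 h2]
    congr 1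
    unfold cyclicShift; split_ifs <;> omega
  · rw [rotateSeq_of_not_mem (by omega), ha i (by omega)]

lemma finite_setOf_bounded_seq (N : ℕ) :
    {a : ℕ → ℕ | (∀ i, 1 ≤ i → i ≤ N → 1 ≤ a i ∧ a i ≤ N) ∧
      ∀ i, i < 1 ∨ N < i → a i = 0}.Finite := by
  refine (Set.finite_range (fun (f : Fin (N + 1) → Fin (N + 1)) (i : ℕ) =>
    if h : i < N + 1 then (f ⟨i, h⟩ : ℕ) else 0)).subset ?_
  rintro a ⟨hb, h0⟩
  have hle : ∀ i, a i < N + 1 := fun i => by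
    by_cases hi : 1 ≤ i ∧ i ≤ N
    · have := (hb i hi.1 hi.2).2
      omega
    · rw [h0 i (by omega)]
      omega
  refine ⟨fun i => ⟨a i, hle i⟩, funext fun i => ?_⟩
  by_cases h : i < N + 1
  · simp [h]
  · simp [h, h0 i (by omega)]

lemma exists_index_eq_one {N : ℕ} {a : ℕ → ℕ} (hN : 1 ≤ N)
    (hb : ∀ i, 1 ≤ i → i ≤ N → 1 ≤ a i ∧ a i ≤ N)
    (hinj : ∀ i j, 1 ≤ i → i ≤ N → 1 ≤ j → j ≤ N → a i = a j → i = j) :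
    ∃ i, 1 ≤ i ∧ i ≤ N ∧ a i = 1 := by
  have hmaps : Set.MapsTo a (Finset.Icc 1 N) (Finset.Icc 1 N) := by
    intro i hi
    simp only [Finset.coe_Icc, Set.mem_Icc] at hi ⊢
    exact hb i hi.1 hi.2
  have hinjOn : Set.InjOn a (Finset.Icc 1 N) := by
    intro i hi j hj h
    simp only [Finset.coe_Icc, Set.mem_Icc] at hi hj
    exact hinj i j hi.1 hi.2 hj.1 hj.2 h
  obtain ⟨i, hi, h⟩ := Finset.surjOn_of_injOn_of_card_le a hmaps hinjOn le_rfl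
    (show 1 ∈ (Finset.Icc 1 N : Set ℕ) by simpa using hN)
  simp only [Finset.coe_Icc, Set.mem_Icc] at hi
  exact ⟨i, hi.1, hi.2, h⟩

lemma arcsCross_iff {p q r s : ℕ} : ArcsCross p q r s ↔
    (StrictlyBetween p q r ∧ ¬ StrictlyBetween p q s) ∨
      (StrictlyBetween p q s ∧ ¬ StrictlyBetween p q r) := Iff.rfl

lemma not_arcsCross_of_not_strictlyBetween {p q r s : ℕ} (hp : p ≠ r ∧ p ≠ s)
    (hq : q ≠ r ∧ q ≠ s) (hr : ¬ StrictlyBetween p q r) (hs : ¬ StrictlyBetween p q s) :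
    ¬ ArcsCross p q r s ∧ ¬ ArcsCross r s p q := by
  simp only [arcsCross_iff, StrictlyBetween] at *
  omega

lemma not_arcsCross_self (p q : ℕ) : ¬ ArcsCross p q p q := by
  simp only [arcsCross_iff, StrictlyBetween]
  omega

lemma IsClosedMeandricPerm.isOpenMeandricPerm {n : ℕ} {a : ℕ → ℕ}
    (h : IsClosedMeandricPerm n a) : IsOpenMeandricPerm (2 * n) a := by
  obtain ⟨hn, h1, hb, hinj, hpar, hup, hlow, hwrap⟩ := h
  refine ⟨by omega, hb, hinj, hpar, hup, hlow, fun i _ hi1 hi => ?_, ?_⟩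
  · have := hb i hi1 hi.le
    have := hb (i + 1) (by omega) hi
    simp only [StrictlyBetween, h1]
    omega
  · rw [if_pos (even_two_mul n)]
    intro i hie hi1 hi
    have hc := (hwrap i hie hi1 hi).1
    have := hb i hi1 hi.le
    have := hb (i + 1) (by omega) hi
    simp only [arcsCross_iff, StrictlyBetween, h1] at hc ⊢
    omega

/-- Joining the two ends of an open meander of even order creates no crossing. -/
lemma IsOpenMeandricPerm.not_arcsCross_cyclicSucc {n : ℕ} {a : ℕ → ℕ}
    (h : IsOpenMeandricPerm (2 * n) a) {i j : ℕ} (hi1 : 1 ≤ i) (hi : i ≤ 2 * n)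
    (hj1 : 1 ≤ j) (hj : j ≤ 2 * n) (hij : i % 2 = j % 2) :
    ¬ ArcsCross (a i) (a (cyclicSucc (2 * n) i)) (a j) (a (cyclicSucc (2 * n) j)) := by
  obtain ⟨hn, -, hinj, -, hup, hlow, hfst, hlst⟩ := h
  rw [if_pos (even_two_mul n)] at hlst
  have hwrap : ∀ i, Even i → 1 ≤ i → i < 2 * n →
      ¬ ArcsCross (a i) (a (i + 1)) (a (2 * n)) (a 1) ∧
      ¬ ArcsCross (a (2 * n)) (a 1) (a i) (a (i + 1)) := by
    intro i hie hi1 hi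
    have hi2 : 2 ≤ i := by
      obtain ⟨t, rfl⟩ := hie
      omega
    by_cases hlast : i + 1 = 2 * n
    · obtain ⟨t, rfl⟩ := hie
      omega
    · refine not_arcsCross_of_not_strictlyBetween ⟨fun h => ?_, fun h => ?_⟩
        ⟨fun h => ?_, fun h => ?_⟩ (hlst i hie hi1 hi) (hfst i hie hi1 hi)
      all_goals
        have := hinj _ _ (by omega) (by omega) (by omega) (by omega) h
        omega
  rcases Nat.even_or_odd i with hie | hio
  · have hje : Even j := by rw [Nat.even_iff] at *; omega
    unfold cyclicSucc
    split_ifs with h1 h2 h2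
    · exact hlow i j hie hi1 h1 hje hj1 h2
    · obtain rfl : j = 2 * n := by omega
      exact (hwrap i hie hi1 h1).1
    · obtain rfl : i = 2 * n := by omega
      exact (hwrap j hje hj1 h2).2
    · obtain rfl : i = 2 * n := by omega
      obtain rfl : j = 2 * n := by omega
      exact not_arcsCross_self _ _
  · have hjo : Odd j := by rw [Nat.odd_iff] at *; omega
    have h1 : i < 2 * n := by rw [Nat.odd_iff] at hio; omega
    have h2 : j < 2 * n := by rw [Nat.odd_iff] at hjo; omega
    rw [cyclicSucc, cyclicSucc, if_pos h1, if_pos h2]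
    exact hup i j hio h1 hjo h2

/-- Closing an open meander of even order and starting at the crossing labelled `1`
gives a closed meander. -/
lemma IsOpenMeandricPerm.isClosedMeandricPerm_rotateSeq {n k : ℕ} {a : ℕ → ℕ}
    (h : IsOpenMeandricPerm (2 * n) a) (hk : k < n) (hone : a (2 * k + 1) = 1) :
    IsClosedMeandricPerm n (rotateSeq (2 * n) (2 * k) a) := by
  have hm : 2 * k < 2 * n := by omega
  have hnc : ∀ i j, 1 ≤ i → i ≤ 2 * n → 1 ≤ j → j ≤ 2 * n → i % 2 = j % 2 →
      ¬ ArcsCross (rotateSeq (2 * n) (2 * k) a i)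
        (rotateSeq (2 * n) (2 * k) a (cyclicSucc (2 * n) i))
        (rotateSeq (2 * n) (2 * k) a j)
        (rotateSeq (2 * n) (2 * k) a (cyclicSucc (2 * n) j)) := by
    intro i j hi1 hi hj1 hj hij
    rw [rotateSeq_cyclicSucc hm hi1 hi, rotateSeq_cyclicSucc hm hj1 hj,
      rotateSeq_of_mem hi1 hi, rotateSeq_of_mem hj1 hj]
    obtain ⟨hi1', hi'⟩ := cyclicShift_mem hm.le hi1 hi
    obtain ⟨hj1', hj'⟩ := cyclicShift_mem hm.le hj1 hj
    exact h.not_arcsCross_cyclicSucc hi1' hi' hj1' hj'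
      (by rw [cyclicShift_mod_two, cyclicShift_mod_two, hij])
  have hsucc : ∀ i, i < 2 * n → cyclicSucc (2 * n) i = i + 1 := fun i hi => if_pos hi
  have hlast : cyclicSucc (2 * n) (2 * n) = 1 := if_neg (lt_irrefl _)
  obtain ⟨-, hb, hinj, hpar, -⟩ := h
  refine ⟨by omega, ?_, fun i hi1 hi => ?_, fun i j hi1 hi hj1 hj hij => ?_,
    fun i hi1 hi => ?_, fun i j hio hi hjo hj => ?_,
    fun i j hie hi1 hi hje hj1 hj => ?_, fun i hie hi1 hi => ?_⟩
  · rw [rotateSeq_of_mem le_rfl (by omega), cyclicShift, if_pos (by omega), add_comm, hone]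
  · rw [rotateSeq_of_mem hi1 hi]
    obtain ⟨hi1', hi'⟩ := cyclicShift_mem hm.le hi1 hi
    exact hb _ hi1' hi'
  · rw [rotateSeq_of_mem hi1 hi, rotateSeq_of_mem hj1 hj] at hij
    obtain ⟨hi1', hi'⟩ := cyclicShift_mem hm.le hi1 hi
    obtain ⟨hj1', hj'⟩ := cyclicShift_mem hm.le hj1 hj
    exact cyclicShift_inj hi1 hi hj1 hj (hinj _ _ hi1' hi' hj1' hj' hij)
  · rw [rotateSeq_of_mem hi1 hi]
    obtain ⟨hi1', hi'⟩ := cyclicShift_mem hm.le hi1 hi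
    rw [hpar _ hi1' hi', cyclicShift_mod_two]
  · rw [← hsucc i hi, ← hsucc j hj]
    rw [Nat.odd_iff] at hio hjo
    exact hnc i j (by omega) hi.le (by omega) hj.le (by omega)
  · rw [← hsucc i hi, ← hsucc j hj]
    rw [Nat.even_iff] at hie hje
    exact hnc i j hi1 hi.le hj1 hj.le (by omega)
  · rw [Nat.even_iff] at hie
    have h1 := hnc i (2 * n) hi1 hi.le (by omega) le_rfl (by omega)
    have h2 := hnc (2 * n) i (by omega) le_rfl hi1 hi.le (by omega)
    rw [hsucc i hi, hlast] at h1 h2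
    exact ⟨h1, h2⟩

/-- For every `n ≥ 1`, `M̄ n ≤ M (2n) ≤ n * M̄ n`. -/
theorem closed_le_openMeanderCount_le (n : ℕ) (hn : 1 ≤ n) :
    closedMeanderCount n ≤ openMeanderCount (2 * n) ∧
      openMeanderCount (2 * n) ≤ n * closedMeanderCount n := by
  constructor
  · exact Set.ncard_le_ncard (fun a ha => ⟨ha.1.isOpenMeandricPerm, ha.2⟩)
      ((finite_setOf_bounded_seq (2 * n)).subset fun a ha => ⟨ha.1.2.1, ha.2⟩)
  · have hfin : {c : ℕ → ℕ | IsClosedMeandricPerm n c ∧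
        ∀ i, i < 1 ∨ 2 * n < i → c i = 0}.Finite :=
      (finite_setOf_bounded_seq (2 * n)).subset fun c hc => ⟨hc.1.2.2.1, hc.2⟩
    have hprod := (Set.finite_Iio n).prod hfin
    calc openMeanderCount (2 * n)
        ≤ ((fun p : ℕ × (ℕ → ℕ) => rotateSeq (2 * n) (2 * n - 2 * p.1) p.2) ''
            (Set.Iio n ×ˢ {c : ℕ → ℕ | IsClosedMeandricPerm n c ∧
              ∀ i, i < 1 ∨ 2 * n < i → c i = 0})).ncard := by
          refine Set.ncard_le_ncard ?_ (hprod.image _)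
          rintro a ⟨ha, h0⟩
          obtain ⟨i, hi1, hi, hone⟩ := exists_index_eq_one (by omega) ha.2.1 ha.2.2.1
          have hpar := ha.2.2.2.1 i hi1 hi
          rw [hone] at hpar
          obtain ⟨k, rfl⟩ : ∃ k, i = 2 * k + 1 := ⟨i / 2, by omega⟩
          have hk : k < n := by omega
          exact ⟨(k, rotateSeq (2 * n) (2 * k) a),
            ⟨hk, ha.isClosedMeandricPerm_rotateSeq hk hone, fun _ => rotateSeq_of_not_mem⟩,
            rotateSeq_rotateSeq (by omega) h0⟩
      _ ≤ _ := Set.ncard_image_le hprod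
      _ = n * closedMeanderCount n := by
          rw [Set.ncard_prod, closedMeanderCount, ← Finset.coe_Iio, Set.ncard_coe_finset,
            Nat.card_Iio]
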